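/- Let g : (0,1) → ℝ be defined by g(Q) = Q^{1/8} · ∏_{n=1}^∞ [(1 − Q^{4n−3})(1 − Q^{4n−1})] / (1 − Q^{4n−2})². Then g is differentiable at Q = e^{−π} and g′(e^{−π}) = e^{π} Γ(1/4)⁴ / (64 · 2^{5/8} · π³), where Γ is the Gamma function. -/

import Mathlib

open Real

/-- `g(Q) = Q^{1/8} (Q; Q⁴)_∞ (Q³; Q⁴)_∞ / (Q²; Q⁴)_∞²`. -/
noncomputable def g (Q : ℝ) : ℝ :=
  Q ^ ((1 : ℝ) / 8) *
    ∏' n : ℕ,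
      (1 - Q ^ (4 * n + 1)) * (1 - Q ^ (4 * n + 3)) / (1 - Q ^ (4 * n + 2)) ^ 2

section ThetaFunctions

open Filter Topology Set MeasureTheory

/-- The theta constant `θ₃ = ∑ q ^ (n ^ 2)` at the nome `q = exp (-y)`. -/
noncomputable def theta3 (y : ℝ) : ℝ := ∑' n : ℤ, exp (-y * (n : ℝ) ^ 2)

/-- The theta constant `θ₄ = ∑ (-1) ^ n q ^ (n ^ 2)` at the nome `q = exp (-y)`. -/
noncomputable def theta4 (y : ℝ) : ℝ := ∑' n : ℤ, (-1) ^ n * exp (-y * (n : ℝ) ^ 2)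

/-- The series `∑ q ^ (n ^ 2 + n)` at the nome `q = exp (-y)`. -/
noncomputable def theta2Aux (y : ℝ) : ℝ := ∑' n : ℤ, exp (-y * ((n : ℝ) ^ 2 + n))

/-- The theta constant `θ₂ = ∑ q ^ ((n + 1 / 2) ^ 2)` at the nome `q = exp (-y)`. -/
noncomputable def theta2 (y : ℝ) : ℝ := exp (-y / 4) * theta2Aux y

lemma summable_exp_neg_mul_sq {y : ℝ} (hy : 0 < y) :
    Summable fun n : ℤ ↦ exp (-y * (n : ℝ) ^ 2) := by
  have key : Summable fun n : ℕ ↦ exp (-y * (n : ℝ) ^ 2) := by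
    refine Summable.of_nonneg_of_le (fun n ↦ (exp_pos _).le) (fun n ↦ ?_)
      (summable_geometric_of_lt_one (exp_pos (-y)).le (by simpa using hy))
    rw [← exp_nat_mul, exp_le_exp]
    have : (n : ℝ) ≤ (n : ℝ) ^ 2 := by exact_mod_cast Nat.le_self_pow two_ne_zero n
    nlinarith
  refine Summable.of_nat_of_neg (by simpa using key) (by simpa using key)

lemma summable_exp_neg_mul_sq_add {y : ℝ} (hy : 0 < y) :
    Summable fun n : ℤ ↦ exp (-y * ((n : ℝ) ^ 2 + n)) := by
  refine Summable.of_nonneg_of_le (fun n ↦ (exp_pos _).le) (fun n ↦ ?_)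
    ((summable_exp_neg_mul_sq (half_pos hy)).mul_left (exp (y / 2)))
  rw [← exp_add, exp_le_exp]
  nlinarith [sq_nonneg ((n : ℝ) + 1)]

lemma abs_neg_one_zpow_mul_exp (n : ℤ) (x : ℝ) : |(-1) ^ n * exp x| = exp x := by
  rw [abs_mul, abs_zpow]; simp

lemma summable_neg_one_zpow_mul_exp {y : ℝ} (hy : 0 < y) :
    Summable fun n : ℤ ↦ (-1) ^ n * exp (-y * (n : ℝ) ^ 2) := by
  refine Summable.of_abs ?_
  simpa only [abs_neg_one_zpow_mul_exp] using summable_exp_neg_mul_sq hy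

lemma one_le_theta3 {y : ℝ} (hy : 0 < y) : 1 ≤ theta3 y := by
  simpa [theta3] using (summable_exp_neg_mul_sq hy).le_tsum 0 (fun n _ ↦ (exp_pos _).le)

lemma theta3_pos {y : ℝ} (hy : 0 < y) : 0 < theta3 y := by
  linarith [one_le_theta3 hy]

lemma one_le_theta2Aux {y : ℝ} (hy : 0 < y) : 1 ≤ theta2Aux y := by
  simpa [theta2Aux] using (summable_exp_neg_mul_sq_add hy).le_tsum 0 (fun n _ ↦ (exp_pos _).le)

lemma theta2_pos {y : ℝ} (hy : 0 < y) : 0 < theta2 y :=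
  mul_pos (exp_pos _) (by linarith [one_le_theta2Aux hy])

lemma hasSum_theta3 {y : ℝ} (hy : 0 < y) :
    HasSum (fun n : ℤ ↦ exp (-y * (n : ℝ) ^ 2)) (theta3 y) :=
  (summable_exp_neg_mul_sq hy).hasSum

lemma hasSum_theta4 {y : ℝ} (hy : 0 < y) :
    HasSum (fun n : ℤ ↦ (-1) ^ n * exp (-y * (n : ℝ) ^ 2)) (theta4 y) :=
  (summable_neg_one_zpow_mul_exp hy).hasSum

lemma hasSum_theta2 {y : ℝ} (hy : 0 < y) :
    HasSum (fun n : ℤ ↦ exp (-y * ((n : ℝ) + 1 / 2) ^ 2)) (theta2 y) := by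
  have h : HasSum _ (theta2 y) :=
    (summable_exp_neg_mul_sq_add hy).hasSum.mul_left (exp (-y / 4))
  convert! h using 2 with n
  rw [← exp_add]
  ring_nf

lemma bijective_sum_elim_int :
    Function.Bijective (Sum.elim (fun n : ℤ ↦ 2 * n) (fun n : ℤ ↦ 2 * n + 1)) := by
  constructor
  · rintro (a | a) (b | b) h <;>
      simp only [Sum.elim_inl, Sum.elim_inr, Sum.inl.injEq, Sum.inr.injEq, reduceCtorEq] at h ⊢ <;>
      omega
  · intro m
    rcases Int.even_or_odd' m with ⟨k, hk | hk⟩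
    · exact ⟨.inl k, hk.symm⟩
    · exact ⟨.inr k, hk.symm⟩

lemma hasSum_int_even_add_odd {F : ℤ → ℝ} {a b : ℝ} (ha : HasSum (fun n ↦ F (2 * n)) a)
    (hb : HasSum (fun n ↦ F (2 * n + 1)) b) : HasSum F (a + b) :=
  (Equiv.ofBijective _ bijective_sum_elim_int).hasSum_iff.mp (HasSum.sum ha hb)

/-- Splitting the series of `θ₃` and `θ₄` by parity. -/
lemma theta3_eq_add {y : ℝ} (hy : 0 < y) : theta3 y = theta3 (4 * y) + theta2 (4 * y) := by
  refine (hasSum_theta3 hy).unique (hasSum_int_even_add_odd ?_ ?_)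
  · convert! hasSum_theta3 (y := 4 * y) (by linarith) using 3 with n
    push_cast; ring
  · convert! hasSum_theta2 (y := 4 * y) (by linarith) using 3 with n
    push_cast; ring

lemma theta4_eq_sub {y : ℝ} (hy : 0 < y) : theta4 y = theta3 (4 * y) - theta2 (4 * y) := by
  rw [sub_eq_add_neg]
  refine (hasSum_theta4 hy).unique (hasSum_int_even_add_odd ?_ ?_)
  · convert! hasSum_theta3 (y := 4 * y) (by linarith) using 2 with n
    rw [(even_two_mul n).neg_one_zpow, one_mul]
    congr 1
    push_cast; ring
  · convert! (hasSum_theta2 (y := 4 * y) (by linarith)).neg using 2 with n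
    rw [(odd_two_mul_add_one n).neg_one_zpow, neg_one_mul]
    congr 2
    push_cast; ring

/-- The decomposition of `ℤ × ℤ` into the pairs with even and with odd sum of coordinates. -/
lemma bijective_sum_elim_int_prod : Function.Bijective
    (Sum.elim (fun p : ℤ × ℤ ↦ (p.1 + p.2, p.1 - p.2))
      (fun p : ℤ × ℤ ↦ (p.1 + p.2 + 1, p.1 - p.2))) := by
  constructor
  · rintro (⟨a, b⟩ | ⟨a, b⟩) (⟨c, d⟩ | ⟨c, d⟩) h <;>
      simp only [Sum.elim_inl, Sum.elim_inr, Prod.mk.injEq, Sum.inl.injEq, Sum.inr.injEq,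
        reduceCtorEq] at h ⊢ <;> omega
  · rintro ⟨m, n⟩
    rcases Int.even_or_odd (m + n) with ⟨k, hk⟩ | ⟨k, hk⟩
    · exact ⟨.inl (k, m - k), by simp only [Sum.elim_inl, Prod.mk.injEq]; omega⟩
    · exact ⟨.inr (k, m - k - 1), by simp only [Sum.elim_inr, Prod.mk.injEq]; omega⟩

lemma hasSum_int_prod_even_add_odd {F : ℤ × ℤ → ℝ} {a b : ℝ}
    (ha : HasSum (fun p : ℤ × ℤ ↦ F (p.1 + p.2, p.1 - p.2)) a)
    (hb : HasSum (fun p : ℤ × ℤ ↦ F (p.1 + p.2 + 1, p.1 - p.2)) b) : HasSum F (a + b) :=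
  (Equiv.ofBijective _ bijective_sum_elim_int_prod).hasSum_iff.mp (HasSum.sum ha hb)

lemma HasSum.mul_self_of_norm {F : ℤ → ℝ} {a : ℝ} (h : HasSum F a) (hF : Summable fun n ↦ ‖F n‖) :
    HasSum (fun p : ℤ × ℤ ↦ F p.1 * F p.2) (a ^ 2) := by
  rw [sq]
  exact h.mul h (summable_mul_of_summable_norm hF hF)

lemma hasSum_theta3_sq {y : ℝ} (hy : 0 < y) :
    HasSum (fun p : ℤ × ℤ ↦ exp (-y * (p.1 : ℝ) ^ 2) * exp (-y * (p.2 : ℝ) ^ 2))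
      (theta3 y ^ 2) :=
  (hasSum_theta3 hy).mul_self_of_norm (by simpa using summable_exp_neg_mul_sq hy)

lemma hasSum_theta2_sq {y : ℝ} (hy : 0 < y) :
    HasSum (fun p : ℤ × ℤ ↦
      exp (-y * ((p.1 : ℝ) + 1 / 2) ^ 2) * exp (-y * ((p.2 : ℝ) + 1 / 2) ^ 2))
      (theta2 y ^ 2) :=
  (hasSum_theta2 hy).mul_self_of_norm (by simpa using (hasSum_theta2 hy).summable)

lemma theta3_sq {y : ℝ} (hy : 0 < y) :
    theta3 y ^ 2 = theta3 (2 * y) ^ 2 + theta2 (2 * y) ^ 2 := by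
  refine (hasSum_theta3_sq hy).unique (hasSum_int_prod_even_add_odd ?_ ?_)
  · convert! hasSum_theta3_sq (y := 2 * y) (by linarith) using 2 with p
    simp only [← exp_add]
    push_cast; ring_nf
  · convert! hasSum_theta2_sq (y := 2 * y) (by linarith) using 2 with p
    simp only [← exp_add]
    push_cast; ring_nf

lemma theta4_sq {y : ℝ} (hy : 0 < y) :
    theta4 y ^ 2 = theta3 (2 * y) ^ 2 - theta2 (2 * y) ^ 2 := by
  rw [sub_eq_add_neg]
  refine ((hasSum_theta4 hy).mul_self_of_norm ?_).unique (hasSum_int_prod_even_add_odd ?_ ?_)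
  · simpa only [norm_eq_abs, abs_neg_one_zpow_mul_exp] using summable_exp_neg_mul_sq hy
  · convert! hasSum_theta3_sq (y := 2 * y) (by linarith) using 2 with p
    rw [mul_mul_mul_comm, ← zpow_add₀ (by norm_num), Even.neg_one_zpow ⟨p.1, by ring⟩, one_mul]
    simp only [← exp_add]
    push_cast; ring_nf
  · convert! (hasSum_theta2_sq (y := 2 * y) (by linarith)).neg using 2 with p
    rw [mul_mul_mul_comm, ← zpow_add₀ (by norm_num), Odd.neg_one_zpow ⟨p.1, by ring⟩, neg_one_mul]
    simp only [← exp_add]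
    push_cast; ring_nf

lemma theta3_mul_theta4 {y : ℝ} (hy : 0 < y) : theta3 y * theta4 y = theta4 (2 * y) ^ 2 := by
  rw [theta3_eq_add hy, theta4_eq_sub hy, theta4_sq (by linarith : 0 < 2 * y)]
  ring_nf

/-- Landen's transformation for `θ₂`. -/
lemma theta2_sq {y : ℝ} (hy : 0 < y) :
    theta2 y ^ 2 = 2 * theta2 (2 * y) * theta3 (2 * y) := by
  have hy' : 0 < y / 2 := by linarith
  have h3 := theta3_sq hy'
  have h4 := theta4_sq hy'
  have h5 := theta3_eq_add hy'
  have h6 := theta4_eq_sub hy'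
  rw [show 2 * (y / 2) = y by ring] at h3 h4
  rw [show 4 * (y / 2) = 2 * y by ring] at h5 h6
  rw [h5] at h3
  rw [h6] at h4
  linear_combination (h4 - h3) / 2

/-- Jacobi's quartic identity. -/
lemma theta3_pow_four {y : ℝ} (hy : 0 < y) :
    theta3 y ^ 4 = theta2 y ^ 4 + theta4 y ^ 4 := by
  linear_combination (theta3 y ^ 2 + theta3 (2 * y) ^ 2 + theta2 (2 * y) ^ 2) * theta3_sq hy -
    (theta4 y ^ 2 + theta3 (2 * y) ^ 2 - theta2 (2 * y) ^ 2) * theta4_sq hy -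
    (theta2 y ^ 2 + 2 * theta2 (2 * y) * theta3 (2 * y)) * theta2_sq hy

/-- The functional equation of `θ₃` at the fixed point `y = π`. -/
lemma theta2_pi_eq_theta4_pi : theta2 π = theta4 π := by
  have hp := pi_pos
  have h1 := theta3_eq_add (y := π / 4) (by positivity)
  have h2 := theta3_eq_add hp
  have h3 := theta4_eq_sub hp
  have h4 : theta3 (π / 4) = 2 * theta3 (4 * π) := by
    have := Real.tsum_exp_neg_mul_int_sq (a := 1 / 4) (by norm_num)
    have h : ((1 : ℝ) / 4) ^ ((1 : ℝ) / 2) = 1 / 2 := by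
      rw [← sqrt_eq_rpow, sqrt_eq_iff_mul_self_eq] <;> norm_num
    rw [h] at this
    convert! this using 1
    · simp only [theta3]; congr 1; ext n; ring_nf
    · simp only [theta3]; norm_num; congr 1; ext n; ring_nf
  rw [show 4 * (π / 4) = π by ring] at h1
  linarith

lemma theta3_pi_pow_four : theta3 π ^ 4 = 2 * theta4 π ^ 4 := by
  rw [theta3_pow_four pi_pos, theta2_pi_eq_theta4_pi]; ring

lemma tendsto_theta3 : Tendsto theta3 atTop (𝓝 1) := by
  have h := tendsto_tsum_of_dominated_convergence (𝓕 := atTop)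
    (f := fun (y : ℝ) (n : ℤ) ↦ exp (-y * (n : ℝ) ^ 2)) (g := fun n ↦ if n = 0 then 1 else 0)
    (summable_exp_neg_mul_sq one_pos) (fun n ↦ ?_) ?_
  · rwa [tsum_ite_eq] at h
  · by_cases hn : n = 0
    · simp [hn]
    · have : (0 : ℝ) < (n : ℝ) ^ 2 := by positivity
      simpa only [hn, if_false, neg_mul] using!
        tendsto_exp_neg_atTop_nhds_zero.comp (tendsto_id.atTop_mul_const this)
  · filter_upwards [eventually_ge_atTop 1] with y hy n
    rw [norm_of_nonneg (exp_pos _).le, exp_le_exp]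
    nlinarith [sq_nonneg (n : ℝ)]

lemma tendsto_theta4 : Tendsto theta4 atTop (𝓝 1) := by
  have h2 : Tendsto (fun y ↦ 2 * theta3 (4 * y) - theta3 y) atTop (𝓝 (2 * 1 - 1)) :=
    ((tendsto_theta3.comp (tendsto_id.const_mul_atTop (by norm_num))).const_mul 2).sub
      tendsto_theta3
  norm_num at h2
  refine h2.congr' ?_
  filter_upwards [eventually_gt_atTop 0] with y hy
  rw [theta4_eq_sub hy, theta3_eq_add hy]; ring

lemma tendsto_two_pow_mul {y : ℝ} (hy : 0 < y) :
    Tendsto (fun n : ℕ ↦ 2 ^ n * y) atTop atTop :=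
  (tendsto_pow_atTop_atTop_of_one_lt one_lt_two).atTop_mul_const hy

/-- A function invariant under `y ↦ 2 * y` is equal to its limit at infinity. -/
lemma eq_of_tendsto_of_two_mul {F : ℝ → ℝ} {c : ℝ} (hF : Tendsto F atTop (𝓝 c))
    (h : ∀ y, 0 < y → F y = F (2 * y)) {y : ℝ} (hy : 0 < y) : F y = c := by
  have h2 : ∀ n : ℕ, F (2 ^ n * y) = F y := by
    intro n
    induction n with
    | zero => simp
    | succ n ih => rw [pow_succ', mul_assoc, ← h _ (by positivity), ih]
  refine tendsto_nhds_unique ?_ (hF.comp (tendsto_two_pow_mul hy))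
  simp [Function.comp_def, h2]

lemma theta4_ne_zero {y : ℝ} (hy : 0 < y) : theta4 y ≠ 0 := by
  intro h0
  have h : ∀ n : ℕ, theta4 (2 ^ n * y) = 0 := by
    intro n
    induction n with
    | zero => simpa using h0
    | succ n ih =>
      have := theta3_mul_theta4 (y := 2 ^ n * y) (by positivity)
      rw [ih, mul_zero] at this
      rw [pow_succ', mul_assoc]
      exact (pow_eq_zero_iff two_ne_zero).mp this.symm
  have := tendsto_theta4.comp (tendsto_two_pow_mul hy)
  simp [Function.comp_def, h] at this

lemma mul_exp_neg_mul_le {a y : ℝ} (hy : 0 < y) :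
    a * exp (-y * a) ≤ 2 / y * exp (-(y / 2) * a) := by
  have h1 : y / 2 * a ≤ exp (y / 2 * a) := by linarith [add_one_le_exp (y / 2 * a)]
  have h2 : exp (-(y / 2) * a) = exp (y / 2 * a) * exp (-y * a) := by
    rw [← exp_add]; ring_nf
  rw [h2, ← mul_assoc]
  refine mul_le_mul_of_nonneg_right ?_ (exp_pos _).le
  rw [div_mul_eq_mul_div, le_div_iff₀ hy]
  linarith

lemma summable_mul_exp_neg_mul {a : ℤ → ℝ} (ha : ∀ n, 0 ≤ a n)
    (hs : ∀ y, 0 < y → Summable fun n ↦ exp (-y * a n)) {y : ℝ} (hy : 0 < y) :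
    Summable fun n ↦ a n * exp (-y * a n) :=
  .of_nonneg_of_le (fun n ↦ mul_nonneg (ha n) (exp_pos _).le)
    (fun _ ↦ mul_exp_neg_mul_le hy) ((hs _ (half_pos hy)).mul_left (2 / y))

lemma hasDerivAt_tsum_exp_neg_mul {a : ℤ → ℝ} (ha : ∀ n, 0 ≤ a n)
    (hs : ∀ y, 0 < y → Summable fun n ↦ exp (-y * a n)) {y : ℝ} (hy : 0 < y) :
    HasDerivAt (fun y ↦ ∑' n, exp (-y * a n)) (-∑' n, a n * exp (-y * a n)) y := by
  have hmem : y ∈ Ioi (y / 2) := half_lt_self hy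
  have hd : ∀ (n : ℤ) (z : ℝ), z ∈ Ioi (y / 2) →
      HasDerivAt (fun z ↦ exp (-z * a n)) (-(a n * exp (-z * a n))) z := by
    intro n z _
    convert! ((hasDerivAt_neg z).mul_const (a n)).exp using 1
    ring
  have hb : ∀ (n : ℤ) (z : ℝ), z ∈ Ioi (y / 2) →
      ‖-(a n * exp (-z * a n))‖ ≤ a n * exp (-(y / 2) * a n) := by
    intro n z hz
    rw [norm_neg, norm_of_nonneg (mul_nonneg (ha n) (exp_pos _).le)]
    refine mul_le_mul_of_nonneg_left (exp_le_exp.mpr ?_) (ha n)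
    nlinarith [ha n, mem_Ioi.mp hz]
  have h := hasDerivAt_tsum_of_isPreconnected (summable_mul_exp_neg_mul ha hs (half_pos hy))
    isOpen_Ioi isPreconnected_Ioi hd hb hmem (hs y hy) hmem
  rwa [tsum_neg] at h

lemma tendsto_tsum_mul_exp_neg_mul {a : ℤ → ℝ} (ha : ∀ n, 0 ≤ a n)
    (hs : ∀ y, 0 < y → Summable fun n ↦ exp (-y * a n)) :
    Tendsto (fun y ↦ -∑' n, a n * exp (-y * a n)) atTop (𝓝 0) := by
  have h := tendsto_tsum_of_dominated_convergence (𝓕 := atTop)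
    (f := fun (y : ℝ) (n : ℤ) ↦ a n * exp (-y * a n)) (g := fun _ ↦ 0)
    (summable_mul_exp_neg_mul ha hs one_pos) (fun n ↦ ?_) ?_
  · simpa using h.neg
  · rcases (ha n).eq_or_lt with hn | hn
    · simp [← hn]
    · simpa only [neg_mul, mul_zero, id, Function.comp_def] using
        (tendsto_exp_neg_atTop_nhds_zero.comp
          (tendsto_id.atTop_mul_const hn)).const_mul (a n)
  · filter_upwards [eventually_ge_atTop 1] with y hy n
    rw [norm_of_nonneg (mul_nonneg (ha n) (exp_pos _).le)]
    refine mul_le_mul_of_nonneg_left (exp_le_exp.mpr ?_) (ha n)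
    nlinarith [ha n]

lemma int_cast_sq_add_self_nonneg (n : ℤ) : (0 : ℝ) ≤ (n : ℝ) ^ 2 + n := by
  rcases le_or_gt 0 n with hn | hn
  · positivity
  · have : (n : ℝ) ≤ -1 := by exact_mod_cast Int.le_sub_one_of_lt hn
    nlinarith

/-- The quotient `θ₂ / θ₃`, i.e. the square root of the elliptic modulus. -/
noncomputable def sqrtModulus (y : ℝ) : ℝ := theta2 y / theta3 y

lemma sqrtModulus_pos {y : ℝ} (hy : 0 < y) : 0 < sqrtModulus y :=
  div_pos (theta2_pos hy) (theta3_pos hy)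

lemma differentiableAt_theta3 {y : ℝ} (hy : 0 < y) : DifferentiableAt ℝ theta3 y :=
  (hasDerivAt_tsum_exp_neg_mul (fun _ ↦ sq_nonneg _)
    (fun _ ↦ summable_exp_neg_mul_sq) hy).differentiableAt

lemma differentiableAt_theta2Aux {y : ℝ} (hy : 0 < y) : DifferentiableAt ℝ theta2Aux y :=
  (hasDerivAt_tsum_exp_neg_mul int_cast_sq_add_self_nonneg
    (fun _ ↦ summable_exp_neg_mul_sq_add) hy).differentiableAt

lemma tendsto_deriv_theta3 : Tendsto (deriv theta3) atTop (𝓝 0) := by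
  refine (tendsto_tsum_mul_exp_neg_mul (a := fun n ↦ (n : ℝ) ^ 2) (fun _ ↦ sq_nonneg _)
    (fun _ ↦ summable_exp_neg_mul_sq)).congr' ?_
  filter_upwards [eventually_gt_atTop 0] with y hy
  exact (hasDerivAt_tsum_exp_neg_mul (fun _ ↦ sq_nonneg _)
    (fun _ ↦ summable_exp_neg_mul_sq) hy).deriv.symm

lemma tendsto_deriv_theta2Aux : Tendsto (deriv theta2Aux) atTop (𝓝 0) := by
  refine (tendsto_tsum_mul_exp_neg_mul int_cast_sq_add_self_nonneg
    (fun _ ↦ summable_exp_neg_mul_sq_add)).congr' ?_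
  filter_upwards [eventually_gt_atTop 0] with y hy
  exact (hasDerivAt_tsum_exp_neg_mul int_cast_sq_add_self_nonneg
    (fun _ ↦ summable_exp_neg_mul_sq_add) hy).deriv.symm

/-- If `1 ≤ F` and the derivative of `F` tends to zero, so does its logarithmic derivative. -/
lemma tendsto_logDeriv_of_tendsto_deriv {F : ℝ → ℝ} (hF : ∀ y, 0 < y → 1 ≤ F y)
    (h : Tendsto (deriv F) atTop (𝓝 0)) : Tendsto (logDeriv F) atTop (𝓝 0) := by
  refine squeeze_zero_norm' ?_ (tendsto_norm_zero.comp h)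
  filter_upwards [eventually_gt_atTop 0] with y hy
  rw [logDeriv_apply, norm_div]
  exact div_le_self (norm_nonneg _) ((hF y hy).trans (le_abs_self _))

lemma differentiableAt_sqrtModulus {y : ℝ} (hy : 0 < y) : DifferentiableAt ℝ sqrtModulus y := by
  have h2 : DifferentiableAt ℝ theta2 y :=
    DifferentiableAt.mul (by fun_prop) (differentiableAt_theta2Aux hy)
  exact h2.div (differentiableAt_theta3 hy) (theta3_pos hy).ne'

lemma logDeriv_sqrtModulus {y : ℝ} (hy : 0 < y) :
    logDeriv sqrtModulus y = -1 / 4 + logDeriv theta2Aux y - logDeriv theta3 y := by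
  have hA := differentiableAt_theta2Aux hy
  have hA0 : theta2Aux y ≠ 0 := by linarith [one_le_theta2Aux hy]
  have h2 : DifferentiableAt ℝ theta2 y := DifferentiableAt.mul (by fun_prop) hA
  have h := logDeriv_div y (theta2_pos hy).ne' (theta3_pos hy).ne' h2 (differentiableAt_theta3 hy)
  have h' := logDeriv_mul (f := fun y ↦ exp (-y / 4)) (g := theta2Aux) y (exp_pos _).ne' hA0
    (by fun_prop) hA
  have h'' : logDeriv (fun y : ℝ ↦ exp (-y / 4)) y = -1 / 4 := by
    have : HasDerivAt (fun y : ℝ ↦ exp (-y / 4)) (exp (-y / 4) * (-1 / 4)) y :=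
      ((hasDerivAt_neg y).div_const 4).exp
    rw [logDeriv_apply, this.deriv, mul_div_cancel_left₀ _ (exp_pos _).ne']
  rw [h''] at h'
  rw [← h']
  exact h

lemma tendsto_logDeriv_sqrtModulus : Tendsto (logDeriv sqrtModulus) atTop (𝓝 (-1 / 4)) := by
  have h : Tendsto (fun y ↦ -1 / 4 + logDeriv theta2Aux y - logDeriv theta3 y) atTop
      (𝓝 (-1 / 4 + 0 - 0)) :=
    ((tendsto_logDeriv_of_tendsto_deriv (fun _ ↦ one_le_theta2Aux)
      tendsto_deriv_theta2Aux).const_add _).sub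
      (tendsto_logDeriv_of_tendsto_deriv (fun _ ↦ one_le_theta3) tendsto_deriv_theta3)
  rw [add_zero, sub_zero] at h
  refine h.congr' ?_
  filter_upwards [eventually_gt_atTop 0] with y hy
  rw [logDeriv_sqrtModulus hy]

/-- Landen's transformation for the elliptic modulus. -/
lemma sqrtModulus_sq {y : ℝ} (hy : 0 < y) :
    sqrtModulus y ^ 2 * (1 + sqrtModulus (2 * y) ^ 2) = 2 * sqrtModulus (2 * y) := by
  have h3 := (theta3_pos hy).ne'
  have h3' := (theta3_pos (by linarith : 0 < 2 * y)).ne'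
  have h := theta3_sq hy
  simp only [sqrtModulus]
  field_simp
  rw [← h, theta2_sq hy]
  ring

lemma logDeriv_sqrtModulus_two_mul {y : ℝ} (hy : 0 < y) :
    logDeriv sqrtModulus y * (1 + sqrtModulus (2 * y) ^ 2) =
      logDeriv sqrtModulus (2 * y) * (1 - sqrtModulus (2 * y) ^ 2) := by
  have hy2 : 0 < 2 * y := by linarith
  have h1 := (differentiableAt_sqrtModulus hy).hasDerivAt
  have h2 : HasDerivAt (fun y ↦ sqrtModulus (2 * y)) (deriv sqrtModulus (2 * y) * (2 * 1)) y :=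
    (differentiableAt_sqrtModulus hy2).hasDerivAt.comp y ((hasDerivAt_id y).const_mul 2)
  have hl := (h1.fun_pow 2).fun_mul ((h2.fun_pow 2).const_add 1)
  have hr := h2.const_mul 2
  have heq : (fun y ↦ sqrtModulus y ^ 2 * (1 + sqrtModulus (2 * y) ^ 2)) =ᶠ[𝓝 y]
      fun y ↦ 2 * sqrtModulus (2 * y) := by
    filter_upwards [lt_mem_nhds hy] with z hz using sqrtModulus_sq hz
  have key := hl.unique (hr.congr_of_eventuallyEq heq)
  have hu := (sqrtModulus_pos hy).ne'
  have hv := (sqrtModulus_pos hy2).ne'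
  have hrel := sqrtModulus_sq hy
  simp only [logDeriv_apply]
  set u := sqrtModulus y
  set v := sqrtModulus (2 * y)
  set du := deriv sqrtModulus y
  set dv := deriv sqrtModulus (2 * y)
  norm_num at key
  field_simp
  have hu2 : u * (du * v * (1 + v ^ 2)) = u * (u * dv * (1 - v ^ 2)) := by
    linear_combination v / 2 * key - dv * hrel
  exact mul_left_cancel₀ hu hu2

/-- The derivative of the elliptic modulus along the nome. -/
lemma logDeriv_sqrtModulus_eq {y : ℝ} (hy : 0 < y) :
    logDeriv sqrtModulus y = -theta4 y ^ 4 / 4 := by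
  have h := eq_of_tendsto_of_two_mul
    (F := fun y ↦ logDeriv sqrtModulus y / theta4 y ^ 4) (c := -1 / 4) ?_ (fun y hy ↦ ?_) hy
  · have := theta4_ne_zero hy
    field_simp at h
    linarith
  · simpa using! tendsto_logDeriv_sqrtModulus.div (tendsto_theta4.pow 4) (by norm_num)
  · have hy2 : 0 < 2 * y := by linarith
    have h1 := logDeriv_sqrtModulus_two_mul hy
    have h3 := (theta3_pos hy).ne'
    have h3' := (theta3_pos hy2).ne'
    have h4 := theta4_ne_zero hy
    have h4' := theta4_ne_zero hy2
    have ha := theta3_sq hy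
    have hb := theta4_sq hy
    have hc := theta3_mul_theta4 hy
    have hp : logDeriv sqrtModulus y * theta3 y ^ 2 =
        logDeriv sqrtModulus (2 * y) * theta4 y ^ 2 := by
      rw [ha, hb]
      simp only [sqrtModulus] at h1 ⊢
      field_simp at h1
      linear_combination h1
    rw [div_eq_div_iff (by positivity) (by positivity),
      show theta4 (2 * y) ^ 4 = (theta3 y * theta4 y) ^ 2 by rw [hc]; ring]
    linear_combination theta4 y ^ 2 * hp

/-- The finite product `∏_{i < m} (1 - q ^ (2 * (i + 1)))`. -/
noncomputable def qFactorial (q : ℝ) (m : ℕ) : ℝ := ∏ i ∈ Finset.range m, (1 - q ^ (2 * (i + 1)))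

/-- The inverse of `qFactorial q m`, extended by zero to negative `m`. -/
noncomputable def qFactorialInv (q : ℝ) : ℤ → ℝ
  | Int.ofNat m => (qFactorial q m)⁻¹
  | Int.negSucc _ => 0

section JacobiTripleProduct

variable {q : ℝ}

lemma one_sub_pow_pos (hq0 : 0 < q) (hq1 : q < 1) {m : ℕ} (hm : m ≠ 0) : 0 < 1 - q ^ m :=
  sub_pos.mpr (pow_lt_one₀ hq0.le hq1 hm)

lemma qFactorial_pos (hq0 : 0 < q) (hq1 : q < 1) (m : ℕ) : 0 < qFactorial q m :=
  Finset.prod_pos fun _ _ ↦ one_sub_pow_pos hq0 hq1 (by omega)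

lemma qFactorialInv_zero : qFactorialInv q 0 = 1 := by
  change (qFactorial q 0)⁻¹ = 1
  simp [qFactorial]

lemma qFactorialInv_of_neg {m : ℤ} (hm : m < 0) : qFactorialInv q m = 0 := by
  cases m with
  | ofNat m => exact absurd hm (by simp)
  | negSucc m => rfl

lemma qFactorialInv_nonneg (hq0 : 0 < q) (hq1 : q < 1) (m : ℤ) : 0 ≤ qFactorialInv q m := by
  cases m with
  | ofNat m => exact (inv_pos.mpr (qFactorial_pos hq0 hq1 m)).le
  | negSucc m => exact le_rfl

lemma qFactorialInv_sub_one (hq0 : 0 < q) (hq1 : q < 1) (m : ℤ) :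
    qFactorialInv q (m - 1) = (1 - q ^ (2 * m)) * qFactorialInv q m := by
  rcases m with (_ | m) | m
  · simp [qFactorialInv_of_neg]
  · have h1 : Int.ofNat (m + 1) - 1 = Int.ofNat m := by simp
    have h2 : q ^ (2 * Int.ofNat (m + 1)) = q ^ (2 * (m + 1)) := by
      rw [← zpow_natCast]; norm_num
    have h3 := one_sub_pow_pos hq0 hq1 (m := 2 * (m + 1)) (by omega)
    have h4 := qFactorial_pos hq0 hq1 m
    rw [h1, h2]
    simp only [qFactorialInv]
    rw [show qFactorial q (m + 1) = qFactorial q m * (1 - q ^ (2 * (m + 1))) from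
      Finset.prod_range_succ _ _]
    field_simp
  · have h1 : Int.negSucc m - 1 = Int.negSucc (m + 1) := by omega
    simp [h1, qFactorialInv]

/-- The finite form of the Jacobi triple product identity. -/
lemma hasSum_finite_jacobiTripleProduct (hq0 : 0 < q) (hq1 : q < 1) {z : ℝ} (hz : z ≠ 0) (n : ℕ) :
    HasSum (fun j : ℤ ↦ qFactorial q (2 * n) * (qFactorialInv q (n + j) * qFactorialInv q (n - j) *
      (q ^ (j ^ 2) * z ^ j)))
      (∏ k ∈ Finset.range n, (1 + z * q ^ (2 * k + 1)) * (1 + z⁻¹ * q ^ (2 * k + 1))) := by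
  induction n with
  | zero =>
    have : ∀ j : ℤ, j ≠ 0 → qFactorialInv q j * qFactorialInv q (-j) = 0 := by
      intro j hj
      rcases lt_or_gt_of_ne hj with hj | hj
      · rw [qFactorialInv_of_neg hj, zero_mul]
      · rw [qFactorialInv_of_neg (neg_neg_of_pos hj), mul_zero]
    convert! hasSum_ite_eq (0 : ℤ) (1 : ℝ) using 2 with j
    by_cases hj : j = 0
    · simp [hj, qFactorial, qFactorialInv_zero]
    · simp [hj, this j hj]
  | succ n ih =>
    have h1 := ((Equiv.subRight (1 : ℤ)).hasSum_iff.mpr ih).mul_left (q ^ (2 * n + 1) * z)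
    have h2 := ((Equiv.addRight (1 : ℤ)).hasSum_iff.mpr ih).mul_left (q ^ (2 * n + 1) * z⁻¹)
    have h := ((ih.mul_left (1 + q ^ (4 * n + 2))).add h1).add h2
    rw [Finset.prod_range_succ]
    convert! h using 1
    · ext j
      simp only [Function.comp_apply, Equiv.subRight_apply, Equiv.coe_addRight]
      have a1 := qFactorialInv_sub_one hq0 hq1 (n + 1 + j)
      have a2 := qFactorialInv_sub_one hq0 hq1 (n + j)
      have b1 := qFactorialInv_sub_one hq0 hq1 (n + 1 - j)
      have b2 := qFactorialInv_sub_one hq0 hq1 (n - j)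
      rw [show (n : ℤ) + 1 + j - 1 = n + j by ring] at a1
      rw [show (n : ℤ) + 1 - j - 1 = n - j by ring] at b1
      have hf : qFactorial q (2 * (n + 1)) =
          qFactorial q (2 * n) * (1 - q ^ (4 * n + 2)) * (1 - q ^ (4 * n + 4)) := by
        rw [mul_add, qFactorial, Finset.prod_range_succ, Finset.prod_range_succ, qFactorial]
        ring_nf
      have hz1 : z ^ (j - 1) = z ^ j / z := by rw [zpow_sub₀ hz, zpow_one]
      have hz2 : z ^ (j + 1) = z ^ j * z := by rw [zpow_add₀ hz, zpow_one]
      obtain ⟨u, hu⟩ : ∃ u, u = q ^ (2 * (n + 1 + j) : ℤ) := ⟨_, rfl⟩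
      obtain ⟨v, hv⟩ : ∃ v, v = q ^ (2 * (n + 1 - j) : ℤ) := ⟨_, rfl⟩
      have hu' : q ^ (2 * (n + j) : ℤ) = u / q ^ 2 := by
        rw [hu, ← zpow_natCast, ← zpow_sub₀ hq0.ne']; push_cast; ring_nf
      have hv' : q ^ (2 * (n - j) : ℤ) = v / q ^ 2 := by
        rw [hv, ← zpow_natCast, ← zpow_sub₀ hq0.ne']; push_cast; ring_nf
      have huv : q ^ (4 * n + 4) = u * v := by
        rw [hu, hv, ← zpow_natCast, ← zpow_add₀ hq0.ne']; push_cast; ring_nf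
      have huv' : q ^ (4 * n + 2) = u * v / q ^ 2 := by
        rw [← huv, eq_div_iff (by positivity)]; ring
      have hj1 : q ^ ((j - 1) ^ 2) * q ^ (2 * n + 1) = q ^ (j ^ 2) * v := by
        rw [hv, ← zpow_natCast, ← zpow_add₀ hq0.ne', ← zpow_add₀ hq0.ne']; push_cast; ring_nf
      have hj2 : q ^ ((j + 1) ^ 2) * q ^ (2 * n + 1) = q ^ (j ^ 2) * u := by
        rw [hu, ← zpow_natCast, ← zpow_add₀ hq0.ne', ← zpow_add₀ hq0.ne']; push_cast; ring_nf
      rw [← hu] at a1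
      rw [hu', a1] at a2
      rw [← hv] at b1
      rw [hv', b1] at b2
      rw [hf, huv, huv', hz1, hz2,
        show ((n + 1 : ℕ) : ℤ) + j = n + 1 + j by push_cast; ring,
        show ((n + 1 : ℕ) : ℤ) - j = n + 1 - j by push_cast; ring,
        show (n : ℤ) + (j - 1) = n + j - 1 by ring, show (n : ℤ) - (j - 1) = n + 1 - j by ring,
        show (n : ℤ) + (j + 1) = n + 1 + j by ring, show (n : ℤ) - (j + 1) = n - j - 1 by ring,
        a2, b2, a1, b1]
      set A := qFactorialInv q (n + 1 + j)
      set B := qFactorialInv q (n + 1 - j)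
      have e1 : q ^ (2 * n + 1) * z * (qFactorial q (2 * n) *
          ((1 - u / q ^ 2) * ((1 - u) * A) * B * (q ^ ((j - 1) ^ 2) * (z ^ j / z)))) =
          qFactorial q (2 * n) * ((1 - u / q ^ 2) * ((1 - u) * A) * B * z ^ j) *
            (q ^ (j ^ 2) * v) := by
        rw [← hj1]; field_simp
      have e2 : q ^ (2 * n + 1) * z⁻¹ * (qFactorial q (2 * n) *
          (A * ((1 - v / q ^ 2) * ((1 - v) * B)) * (q ^ ((j + 1) ^ 2) * (z ^ j * z)))) =
          qFactorial q (2 * n) * (A * ((1 - v / q ^ 2) * ((1 - v) * B)) * z ^ j) *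
            (q ^ (j ^ 2) * u) := by
        rw [← hj2]; field_simp
      rw [e1, e2]
      field_simp
      ring
    · have : q ^ (4 * n + 2) = (q ^ (2 * n + 1)) ^ 2 := by ring
      rw [this]
      field_simp
      ring

lemma summable_pow_comp (hq0 : 0 < q) (hq1 : q < 1) {e : ℕ → ℕ} (he : ∀ n, n ≤ e n) :
    Summable fun n ↦ q ^ e n :=
  .of_nonneg_of_le (fun _ ↦ by positivity)
    (fun n ↦ pow_le_pow_of_le_one hq0.le hq1.le (he n)) (summable_geometric_of_lt_one hq0.le hq1)

lemma multipliable_one_add_pow (hq0 : 0 < q) (hq1 : q < 1) {e : ℕ → ℕ} (he : ∀ n, n ≤ e n) :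
    Multipliable fun n ↦ 1 + q ^ e n :=
  multipliable_one_add_of_summable (by simpa [abs_of_pos hq0] using summable_pow_comp hq0 hq1 he)

lemma multipliable_one_sub_pow (hq0 : 0 < q) (hq1 : q < 1) {e : ℕ → ℕ} (he : ∀ n, n ≤ e n) :
    Multipliable fun n ↦ 1 - q ^ e n := by
  simp only [sub_eq_add_neg]
  exact multipliable_one_add_of_summable
    (by simpa [abs_of_pos hq0] using summable_pow_comp hq0 hq1 he)

lemma tprod_one_sub_pow_pos (hq0 : 0 < q) (hq1 : q < 1) {e : ℕ → ℕ} (he : ∀ n, n < e n) :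
    0 < ∏' n, (1 - q ^ e n) := by
  have hpos : ∀ n, 0 < 1 - q ^ e n := fun n ↦ one_sub_pow_pos hq0 hq1 (by have := he n; omega)
  have hm := multipliable_one_sub_pow hq0 hq1 (fun n ↦ (he n).le)
  refine lt_of_le_of_ne (ge_of_tendsto' hm.tendsto_prod_tprod_nat
    fun n ↦ Finset.prod_nonneg fun i _ ↦ (hpos i).le) (Ne.symm ?_)
  simp only [sub_eq_add_neg] at hpos ⊢
  exact tprod_one_add_ne_zero_of_summable (fun n ↦ (hpos n).ne')
    (by simpa [abs_of_pos hq0] using summable_pow_comp hq0 hq1 (fun n ↦ (he n).le))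

lemma tendsto_qFactorial (hq0 : 0 < q) (hq1 : q < 1) :
    Tendsto (qFactorial q) atTop (𝓝 (∏' n : ℕ, (1 - q ^ (2 * (n + 1))))) :=
  (multipliable_one_sub_pow hq0 hq1 (fun n ↦ by omega)).tendsto_prod_tprod_nat

lemma tprod_le_qFactorial (hq0 : 0 < q) (hq1 : q < 1) (m : ℕ) :
    ∏' n : ℕ, (1 - q ^ (2 * (n + 1))) ≤ qFactorial q m := by
  have hanti : Antitone (qFactorial q) := antitone_nat_of_succ_le fun m ↦ by
    rw [qFactorial, Finset.prod_range_succ]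
    exact mul_le_of_le_one_right (qFactorial_pos hq0 hq1 m).le
      (by linarith [pow_pos hq0 (2 * (m + 1))])
  exact hanti.le_of_tendsto (tendsto_qFactorial hq0 hq1) m

lemma qFactorialInv_le (hq0 : 0 < q) (hq1 : q < 1) (m : ℤ) :
    qFactorialInv q m ≤ (∏' n : ℕ, (1 - q ^ (2 * (n + 1))))⁻¹ := by
  have hL := tprod_one_sub_pow_pos hq0 hq1 (e := fun n ↦ 2 * (n + 1)) (fun n ↦ by omega)
  cases m with
  | ofNat m => exact inv_anti₀ hL (tprod_le_qFactorial hq0 hq1 m)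
  | negSucc m => exact (inv_pos.mpr hL).le

lemma tendsto_qFactorialInv (hq0 : 0 < q) (hq1 : q < 1) :
    Tendsto (qFactorialInv q) atTop (𝓝 (∏' n : ℕ, (1 - q ^ (2 * (n + 1))))⁻¹) := by
  have hL := tprod_one_sub_pow_pos hq0 hq1 (e := fun n ↦ 2 * (n + 1)) (fun n ↦ by omega)
  have h : Tendsto (fun m : ℤ ↦ (qFactorial q m.toNat)⁻¹) atTop
      (𝓝 (∏' n : ℕ, (1 - q ^ (2 * (n + 1))))⁻¹) :=
    ((tendsto_qFactorial hq0 hq1).inv₀ hL.ne').comp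
      (tendsto_natCast_atTop_iff.mp (tendsto_atTop_mono Int.self_le_toNat tendsto_id))
  refine h.congr' ?_
  filter_upwards [eventually_ge_atTop 0] with m hm
  obtain ⟨m, rfl⟩ := Int.eq_ofNat_of_zero_le hm
  rfl

/-- The Jacobi triple product identity. -/
lemma tendsto_jacobiTripleProduct (hq0 : 0 < q) (hq1 : q < 1) {z : ℝ} (hz : 0 < z)
    (hs : Summable fun j : ℤ ↦ q ^ (j ^ 2) * z ^ j) :
    Tendsto (fun n ↦ (∏' i : ℕ, (1 - q ^ (2 * (i + 1)))) *
        ∏ k ∈ Finset.range n, (1 + z * q ^ (2 * k + 1)) * (1 + z⁻¹ * q ^ (2 * k + 1)))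
      atTop (𝓝 (∑' j : ℤ, q ^ (j ^ 2) * z ^ j)) := by
  have hL := tprod_one_sub_pow_pos hq0 hq1 (e := fun n ↦ 2 * (n + 1)) (fun n ↦ by omega)
  have hf := tendsto_qFactorial hq0 hq1
  have hfi := tendsto_qFactorialInv hq0 hq1
  have hle := qFactorialInv_le hq0 hq1
  set L := ∏' i : ℕ, (1 - q ^ (2 * (i + 1)))
  have h := tendsto_tsum_of_dominated_convergence (𝓕 := atTop)
    (f := fun (n : ℕ) (j : ℤ) ↦ qFactorialInv q (n + j) * qFactorialInv q (n - j) *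
      (q ^ (j ^ 2) * z ^ j)) (g := fun j ↦ L⁻¹ * L⁻¹ * (q ^ (j ^ 2) * z ^ j))
    (hs.mul_left (L⁻¹ * L⁻¹)) (fun j ↦ ?_) ?_
  · have h2 : Tendsto (fun n : ℕ ↦ L * qFactorial q (2 * n)) atTop (𝓝 (L * L)) :=
      (hf.comp (tendsto_id.const_mul_atTop' two_pos)).const_mul L
    have h3 := h2.mul h
    rw [tsum_mul_left, ← mul_assoc, show L * L * (L⁻¹ * L⁻¹) = 1 by field_simp, one_mul] at h3
    refine h3.congr fun n ↦ ?_
    rw [← (hasSum_finite_jacobiTripleProduct hq0 hq1 hz.ne' n).tsum_eq, tsum_mul_left, mul_assoc]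
  · refine Tendsto.mul_const _ (Tendsto.mul (hfi.comp ?_) (hfi.comp ?_))
    · exact tendsto_atTop_add_const_right _ _ tendsto_natCast_atTop_atTop
    · simpa only [sub_eq_add_neg] using
        tendsto_atTop_add_const_right _ _ tendsto_natCast_atTop_atTop
  · refine Eventually.of_forall fun n j ↦ ?_
    have hp := qFactorialInv_nonneg hq0 hq1
    have hLi := (inv_pos.mpr hL).le
    rw [norm_of_nonneg (mul_nonneg (mul_nonneg (hp _) (hp _)) (by positivity))]
    exact mul_le_mul_of_nonneg_right (mul_le_mul (hle _) (hle _) (hp _) hLi) (by positivity)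

end JacobiTripleProduct

section ProductFormulas

variable {q : ℝ}

lemma g_eq_tprod (hq0 : 0 < q) (hq1 : q < 1) :
    g q = q ^ ((1 : ℝ) / 8) *
      ((∏' n : ℕ, (1 - q ^ (2 * n + 1))) / (∏' n : ℕ, (1 - q ^ (4 * n + 2))) ^ 2) := by
  have h1 := multipliable_one_sub_pow hq0 hq1 (e := fun n ↦ 4 * n + 1) (fun n ↦ by omega)
  have h3 := multipliable_one_sub_pow hq0 hq1 (e := fun n ↦ 4 * n + 3) (fun n ↦ by omega)
  have h2 := multipliable_one_sub_pow hq0 hq1 (e := fun n ↦ 4 * n + 2) (fun n ↦ by omega)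
  have hpos := tprod_one_sub_pow_pos hq0 hq1 (e := fun n ↦ 4 * n + 2) (fun n ↦ by omega)
  have hodd : HasProd (fun n : ℕ ↦ 1 - q ^ (2 * n + 1))
      ((∏' n : ℕ, (1 - q ^ (4 * n + 1))) * ∏' n : ℕ, (1 - q ^ (4 * n + 3))) := by
    refine HasProd.even_mul_odd ?_ ?_
    · convert! h1.hasProd using 4
      ring
    · convert! h3.hasProd using 4
      ring
  have h := (h1.hasProd.mul h3.hasProd).div₀ (h2.hasProd.mul h2.hasProd)
    (mul_ne_zero hpos.ne' hpos.ne')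
  rw [hodd.tprod_eq, sq, ← h.tprod_eq]
  simp only [g, sq]

lemma g_pos (hq0 : 0 < q) (hq1 : q < 1) : 0 < g q := by
  rw [g_eq_tprod hq0 hq1]
  have h1 := tprod_one_sub_pow_pos hq0 hq1 (e := fun n ↦ 2 * n + 1) (fun n ↦ by omega)
  have h2 := tprod_one_sub_pow_pos hq0 hq1 (e := fun n ↦ 4 * n + 2) (fun n ↦ by omega)
  positivity

lemma tprod_one_sub_mul_tprod_one_add (hq0 : 0 < q) (hq1 : q < 1) {e : ℕ → ℕ} (he : ∀ n, n ≤ e n) :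
    (∏' n, (1 - q ^ e n)) * ∏' n, (1 + q ^ e n) = ∏' n, (1 - q ^ (2 * e n)) := by
  rw [← (multipliable_one_sub_pow hq0 hq1 he).tprod_mul (multipliable_one_add_pow hq0 hq1 he)]
  congr 1
  ext n
  ring

/-- Euler's identity on partitions into odd and into distinct parts, for the base `q ^ 2`. -/
lemma tprod_one_sub_mul_tprod_one_add_eq_one (hq0 : 0 < q) (hq1 : q < 1) :
    (∏' n : ℕ, (1 - q ^ (4 * n + 2))) * ∏' n : ℕ, (1 + q ^ (2 * (n + 1))) = 1 := by
  have h := tprod_one_sub_mul_tprod_one_add hq0 hq1 (e := fun n ↦ 2 * (n + 1)) (fun n ↦ by omega)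
  have h4 := multipliable_one_sub_pow hq0 hq1 (e := fun n ↦ 2 * (2 * (n + 1))) (fun n ↦ by omega)
  have h2 := multipliable_one_sub_pow hq0 hq1 (e := fun n ↦ 4 * n + 2) (fun n ↦ by omega)
  have hL := tprod_one_sub_pow_pos hq0 hq1 (e := fun n ↦ 2 * (n + 1)) (fun n ↦ by omega)
  have heo : HasProd (fun n : ℕ ↦ 1 - q ^ (2 * (n + 1))) ((∏' n : ℕ, (1 - q ^ (4 * n + 2))) *
      ∏' n : ℕ, (1 - q ^ (2 * (2 * (n + 1))))) := by
    refine HasProd.even_mul_odd ?_ ?_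
    · convert! h2.hasProd using 4
      ring
    · convert! h4.hasProd using 4
  rw [← h] at heo
  refine mul_left_cancel₀ hL.ne' ?_
  rw [mul_one]
  nth_rewrite 2 [heo.tprod_eq]
  ring

lemma exp_zpow_eq_exp_mul (x : ℝ) (j : ℤ) : exp x ^ j = exp (x * j) := by
  rw [← rpow_intCast, ← exp_mul]

lemma exp_neg_zpow_sq (y : ℝ) (j : ℤ) : exp (-y) ^ (j ^ 2) = exp (-y * (j : ℝ) ^ 2) := by
  rw [exp_zpow_eq_exp_mul]; push_cast; rfl

lemma theta3_eq_tprod {y : ℝ} (hy : 0 < y) :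
    theta3 y = (∏' n : ℕ, (1 - exp (-y) ^ (2 * (n + 1)))) *
      (∏' n : ℕ, (1 + exp (-y) ^ (2 * n + 1))) ^ 2 := by
  have hq0 := exp_pos (-y)
  have hq1 : exp (-y) < 1 := by simpa using hy
  have hterm : (fun j : ℤ ↦ exp (-y) ^ (j ^ 2) * (1 : ℝ) ^ j) =
      fun j : ℤ ↦ exp (-y * (j : ℝ) ^ 2) := by
    ext j; rw [exp_neg_zpow_sq, one_zpow, mul_one]
  have h := tendsto_jacobiTripleProduct hq0 hq1 one_pos
    (by simpa only [hterm] using summable_exp_neg_mul_sq hy)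
  have hd := multipliable_one_add_pow hq0 hq1 (e := fun n ↦ 2 * n + 1) (fun n ↦ by omega)
  rw [hterm] at h
  refine tendsto_nhds_unique h ?_
  have h2 := (hd.mul hd).tendsto_prod_tprod_nat.const_mul
      (∏' n : ℕ, (1 - exp (-y) ^ (2 * (n + 1))))
  rw [hd.tprod_mul hd] at h2
  simpa only [sq, one_mul, inv_one] using! h2

lemma theta2Aux_eq_tprod {y : ℝ} (hy : 0 < y) :
    theta2Aux y = (∏' n : ℕ, (1 - exp (-y) ^ (2 * (n + 1)))) *
      (2 * (∏' n : ℕ, (1 + exp (-y) ^ (2 * (n + 1)))) ^ 2) := by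
  have hq0 := exp_pos (-y)
  have hq1 : exp (-y) < 1 := by simpa using hy
  have hterm : (fun j : ℤ ↦ exp (-y) ^ (j ^ 2) * exp (-y) ^ j) =
      fun j : ℤ ↦ exp (-y * ((j : ℝ) ^ 2 + j)) := by
    ext j; rw [exp_neg_zpow_sq, exp_zpow_eq_exp_mul, ← exp_add]; ring_nf
  have h := tendsto_jacobiTripleProduct hq0 hq1 hq0
    (by simpa only [hterm] using summable_exp_neg_mul_sq_add hy)
  have hc := multipliable_one_add_pow hq0 hq1 (e := fun n ↦ 2 * (n + 1)) (fun n ↦ by omega)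
  have hc' := multipliable_one_add_pow hq0 hq1 (e := fun n ↦ 2 * n) (fun n ↦ by omega)
  have hcc : ∏' n : ℕ, (1 + exp (-y) ^ (2 * n)) = 2 * ∏' n : ℕ, (1 + exp (-y) ^ (2 * (n + 1))) := by
    rw [tprod_eq_zero_mul' (f := fun n ↦ 1 + exp (-y) ^ (2 * n)) hc]
    norm_num
  rw [hterm] at h
  refine tendsto_nhds_unique h ?_
  have h2 := (hc.mul hc').tendsto_prod_tprod_nat.const_mul
      (∏' n : ℕ, (1 - exp (-y) ^ (2 * (n + 1))))
  rw [hc.tprod_mul hc', hcc] at h2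
  rw [show ∀ A C : ℝ, A * (2 * C ^ 2) = A * (C * (2 * C)) from fun A C ↦ by ring]
  refine h2.congr fun n ↦ ?_
  congr 1
  refine Finset.prod_congr rfl fun k _ ↦ ?_
  have e1 : exp (-y) * exp (-y) ^ (2 * k + 1) = exp (-y) ^ (2 * (k + 1)) := by ring
  have e2 : (exp (-y))⁻¹ * exp (-y) ^ (2 * k + 1) = exp (-y) ^ (2 * k) := by
    rw [pow_succ]; field_simp
  rw [e1, e2]

end ProductFormulas

lemma two_mul_g_exp_neg_sq {y : ℝ} (hy : 0 < y) : 2 * g (exp (-y)) ^ 2 = sqrtModulus y := by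
  have hq0 := exp_pos (-y)
  have hq1 : exp (-y) < 1 := by simpa using hy
  have hL := tprod_one_sub_pow_pos hq0 hq1 (e := fun n ↦ 2 * (n + 1)) (fun n ↦ by omega)
  have ha := tprod_one_sub_pow_pos hq0 hq1 (e := fun n ↦ 2 * n + 1) (fun n ↦ by omega)
  have hb := tprod_one_sub_pow_pos hq0 hq1 (e := fun n ↦ 4 * n + 2) (fun n ↦ by omega)
  have hbc := tprod_one_sub_mul_tprod_one_add_eq_one hq0 hq1
  have had := tprod_one_sub_mul_tprod_one_add hq0 hq1 (e := fun n ↦ 2 * n + 1) (fun n ↦ by omega)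
  rw [show (fun n : ℕ ↦ 1 - exp (-y) ^ (2 * (2 * n + 1))) = fun n ↦ 1 - exp (-y) ^ (4 * n + 2) by
    ext n; ring] at had
  have hpow : (exp (-y) ^ ((1 : ℝ) / 8)) ^ 2 = exp (-y / 4) := by
    rw [← exp_mul, ← exp_nat_mul]; push_cast; ring_nf
  rw [sqrtModulus, theta2, theta3_eq_tprod hy, theta2Aux_eq_tprod hy, g_eq_tprod hq0 hq1, mul_pow,
    hpow]
  set a := ∏' n : ℕ, (1 - exp (-y) ^ (2 * n + 1))
  set b := ∏' n : ℕ, (1 - exp (-y) ^ (4 * n + 2))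
  set c := ∏' n : ℕ, (1 + exp (-y) ^ (2 * (n + 1)))
  set d := ∏' n : ℕ, (1 + exp (-y) ^ (2 * n + 1))
  have hc : c = 1 / b := by rw [eq_div_iff hb.ne', mul_comm, hbc]
  have hd : d = b / a := by rw [eq_div_iff ha.ne', mul_comm, had]
  rw [hc, hd]
  field_simp

section AGM

/-- The integral of `1 / √((x² + a²)(x² + b²))` over the real line. -/
noncomputable def agmIntegral (a b : ℝ) : ℝ := ∫ x : ℝ, (√((x ^ 2 + a ^ 2) * (x ^ 2 + b ^ 2)))⁻¹

lemma agmIntegral_eq_two_mul (a b : ℝ) :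
    agmIntegral a b = 2 * ∫ x in Ioi (0 : ℝ), (√((x ^ 2 + a ^ 2) * (x ^ 2 + b ^ 2)))⁻¹ := by
  rw [← integral_comp_abs (f := fun x ↦ (√((x ^ 2 + a ^ 2) * (x ^ 2 + b ^ 2)))⁻¹)]
  simp only [sq_abs, agmIntegral]

lemma image_landen_Ioi {c : ℝ} (hc : 0 < c) :
    (fun x : ℝ ↦ (x - c / x) / 2) '' Ioi 0 = univ := by
  refine eq_univ_of_forall fun t ↦ ?_
  have hs : √(t ^ 2 + c) ^ 2 = t ^ 2 + c := sq_sqrt (by positivity)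
  have hlt : |t| < √(t ^ 2 + c) := by
    rw [← sqrt_sq_eq_abs]; exact sqrt_lt_sqrt (sq_nonneg t) (by linarith)
  have hpos : 0 < t + √(t ^ 2 + c) := by linarith [neg_abs_le t]
  refine ⟨t + √(t ^ 2 + c), hpos, ?_⟩
  simp only
  rw [div_eq_iff two_ne_zero, sub_eq_iff_eq_add', ← sub_eq_iff_eq_add, eq_div_iff hpos.ne']
  linear_combination hs

lemma injOn_landen {c : ℝ} (hc : 0 < c) : InjOn (fun x : ℝ ↦ (x - c / x) / 2) (Ioi 0) := by
  intro x hx y hy h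
  have hx' : 0 < x := hx
  have hy' : 0 < y := hy
  have h' : (x - y) * (x * y + c) = 0 := by
    simp only at h
    field_simp at h
    linear_combination h
  rcases mul_eq_zero.mp h' with h0 | h0
  · linarith
  · nlinarith [mul_pos hx' hy']

/-- Gauss's transformation: the integral is invariant under the arithmetic-geometric mean step. -/
lemma agmIntegral_landen {a b A B : ℝ} (ha : 0 < a) (hb : 0 < b) (hA : A = (a + b) / 2)
    (hB : B ^ 2 = a * b) : agmIntegral A B = agmIntegral a b := by
  have hab := mul_pos ha hb
  have hderiv : ∀ x ∈ Ioi (0 : ℝ), HasDerivWithinAt (fun x : ℝ ↦ (x - a * b / x) / 2)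
      ((1 + a * b / x ^ 2) / 2) (Ioi 0) x := by
    intro x hx
    have hx' : x ≠ 0 := (mem_Ioi.mp hx).ne'
    have h := (((hasDerivAt_id x).sub ((hasDerivAt_const x (a * b)).div (hasDerivAt_id x) hx')
      ).div_const 2).hasDerivWithinAt (s := Ioi 0)
    refine h.congr_deriv ?_
    simp only [id]
    field_simp
    ring
  have h := integral_image_eq_integral_abs_deriv_smul measurableSet_Ioi hderiv (injOn_landen hab)
    (fun t ↦ (√((t ^ 2 + A ^ 2) * (t ^ 2 + B ^ 2)))⁻¹)
  rw [image_landen_Ioi hab, setIntegral_univ] at h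
  rw [agmIntegral, h, agmIntegral_eq_two_mul, ← integral_const_mul]
  refine setIntegral_congr_fun measurableSet_Ioi fun x hx ↦ ?_
  have hx' : 0 < x := hx
  have hP : ((x - a * b / x) / 2) ^ 2 + A ^ 2 = (x ^ 2 + a ^ 2) * (x ^ 2 + b ^ 2) / (4 * x ^ 2) := by
    rw [hA]; field_simp; ring
  have hQ : ((x - a * b / x) / 2) ^ 2 + B ^ 2 = (x ^ 2 + a * b) ^ 2 / (4 * x ^ 2) := by
    rw [hB]; field_simp; ring
  have hS : √((x ^ 2 + a ^ 2) * (x ^ 2 + b ^ 2) / (4 * x ^ 2) *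
      ((x ^ 2 + a * b) ^ 2 / (4 * x ^ 2))) =
      √((x ^ 2 + a ^ 2) * (x ^ 2 + b ^ 2)) * ((x ^ 2 + a * b) / (4 * x ^ 2)) := by
    rw [show (x ^ 2 + a ^ 2) * (x ^ 2 + b ^ 2) / (4 * x ^ 2) * ((x ^ 2 + a * b) ^ 2 / (4 * x ^ 2)) =
      (x ^ 2 + a ^ 2) * (x ^ 2 + b ^ 2) * ((x ^ 2 + a * b) / (4 * x ^ 2)) ^ 2 by ring,
      sqrt_mul (by positivity), sqrt_sq (by positivity)]
  have hS0 : 0 < √((x ^ 2 + a ^ 2) * (x ^ 2 + b ^ 2)) := sqrt_pos.mpr (by positivity)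
  simp only [smul_eq_mul]
  rw [hP, hQ, hS, abs_of_pos (by positivity)]
  field_simp
  ring

lemma agmIntegral_one_one : agmIntegral 1 1 = π := by
  rw [agmIntegral, ← integral_univ_inv_one_add_sq]
  congr 1
  ext x
  rw [← sq, sqrt_sq (by positivity), one_pow, add_comm]

lemma tendsto_agmIntegral {ι : Type*} {l : Filter ι} [l.IsCountablyGenerated] {a b : ι → ℝ}
    (ha : Tendsto a l (𝓝 1)) (hb : Tendsto b l (𝓝 1)) :
    Tendsto (fun i ↦ agmIntegral (a i) (b i)) l (𝓝 π) := by
  rw [← agmIntegral_one_one]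
  refine tendsto_integral_filter_of_dominated_convergence (fun x : ℝ ↦ 4 * (1 + x ^ 2)⁻¹)
    ?_ ?_ (integrable_inv_one_add_sq.const_mul 4) ?_
  · exact Eventually.of_forall fun i ↦ (by fun_prop : Measurable _).aestronglyMeasurable
  · filter_upwards [ha.eventually_const_le (by norm_num : (1 / 2 : ℝ) < 1),
      hb.eventually_const_le (by norm_num : (1 / 2 : ℝ) < 1)] with i hai hbi
    refine Eventually.of_forall fun x ↦ ?_
    have h1 : (1 + x ^ 2) / 4 ≤ x ^ 2 + a i ^ 2 := by nlinarith [sq_nonneg x]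
    have h2 : (1 + x ^ 2) / 4 ≤ x ^ 2 + b i ^ 2 := by nlinarith [sq_nonneg x]
    have h3 : (1 + x ^ 2) / 4 ≤ √((x ^ 2 + a i ^ 2) * (x ^ 2 + b i ^ 2)) := by
      refine le_sqrt_of_sq_le ?_
      rw [sq]
      exact mul_le_mul h1 h2 (by positivity) (by positivity)
    rw [norm_of_nonneg (by positivity)]
    calc _ ≤ ((1 + x ^ 2) / 4)⁻¹ := inv_anti₀ (by positivity) h3
      _ = _ := by rw [inv_div, div_eq_mul_inv]
  · refine Eventually.of_forall fun x ↦ ?_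
    refine Tendsto.inv₀ ?_ (sqrt_pos.mpr (by positivity)).ne'
    exact (((ha.pow 2).const_add _).mul ((hb.pow 2).const_add _)).sqrt

lemma agmIntegral_theta {y : ℝ} (hy : 0 < y) : agmIntegral (theta3 y ^ 2) (theta4 y ^ 2) = π := by
  refine eq_of_tendsto_of_two_mul (F := fun y ↦ agmIntegral (theta3 y ^ 2) (theta4 y ^ 2))
    ?_ ?_ hy
  · exact tendsto_agmIntegral (by simpa using tendsto_theta3.pow 2)
      (by simpa using tendsto_theta4.pow 2)
  · intro y hy
    refine (agmIntegral_landen (pow_pos (theta3_pos hy) 2)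
      (sq_pos_of_ne_zero (theta4_ne_zero hy)) ?_ ?_).symm
    · rw [theta3_sq hy, theta4_sq hy]; ring
    · rw [← mul_pow, theta3_mul_theta4 hy]

lemma agmIntegral_mul {c : ℝ} (hc : 0 < c) (a b : ℝ) :
    agmIntegral (c * a) (c * b) = c⁻¹ * agmIntegral a b := by
  have h := Measure.integral_comp_mul_left
    (fun x : ℝ ↦ (√((x ^ 2 + (c * a) ^ 2) * (x ^ 2 + (c * b) ^ 2)))⁻¹) c
  rw [abs_of_pos (inv_pos.mpr hc), smul_eq_mul] at h
  have h2 : ∀ x : ℝ, (√(((c * x) ^ 2 + (c * a) ^ 2) * ((c * x) ^ 2 + (c * b) ^ 2)))⁻¹ =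
      c⁻¹ ^ 2 * (√((x ^ 2 + a ^ 2) * (x ^ 2 + b ^ 2)))⁻¹ := by
    intro x
    rw [show ((c * x) ^ 2 + (c * a) ^ 2) * ((c * x) ^ 2 + (c * b) ^ 2) =
      (c ^ 2) ^ 2 * ((x ^ 2 + a ^ 2) * (x ^ 2 + b ^ 2)) by ring, sqrt_mul (by positivity),
      sqrt_sq (by positivity), mul_inv, inv_pow]
  simp only [h2] at h
  rw [integral_const_mul] at h
  rw [agmIntegral, agmIntegral]
  refine mul_left_cancel₀ (inv_ne_zero hc.ne') ?_
  rw [← h]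
  ring

lemma image_inv_one_add_sq_sq : (fun x : ℝ ↦ ((1 + x ^ 2) ^ 2)⁻¹) '' Ioi 0 = Ioo 0 1 := by
  ext u
  constructor
  · rintro ⟨x, hx, rfl⟩
    have hx' : 0 < x := hx
    exact ⟨by positivity, inv_lt_one_of_one_lt₀ (one_lt_pow₀ (by nlinarith) two_ne_zero)⟩
  · rintro ⟨h0, h1⟩
    have hs : 0 < √u := sqrt_pos.mpr h0
    have h2 : 1 < (√u)⁻¹ := (one_lt_inv₀ hs).mpr ((sqrt_lt' one_pos).mpr (by simpa using h1))
    refine ⟨√((√u)⁻¹ - 1), sqrt_pos.mpr (by linarith), ?_⟩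
    simp only
    rw [sq_sqrt (by linarith), add_sub_cancel, inv_pow, inv_inv, sq_sqrt h0.le]

lemma integral_rpow_mul_one_sub_rpow {α β : ℝ} (hα : 0 < α) (hβ : 0 < β) :
    ∫ u in Ioo (0 : ℝ) 1, u ^ (α - 1) * (1 - u) ^ (β - 1) =
      Gamma α * Gamma β / Gamma (α + β) := by
  have h := ProbabilityTheory.beta_eq_betaIntegralReal α β hα hβ
  rw [ProbabilityTheory.beta] at h
  rw [h, Complex.betaIntegral, intervalIntegral.integral_of_le zero_le_one,
    ← integral_Ioc_eq_integral_Ioo, ← RCLike.re_eq_complex_re, ← integral_re]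
  · refine setIntegral_congr_fun measurableSet_Ioc fun x hx ↦ ?_
    norm_cast
    rw [← Complex.ofReal_cpow hx.1.le, ← Complex.ofReal_cpow (by linarith [hx.2]),
      RCLike.re_eq_complex_re, Complex.re_mul_ofReal, Complex.ofReal_re]
  · have hc := Complex.betaIntegral_convergent (u := α) (v := β) (by simpa) (by simpa)
    rwa [intervalIntegrable_iff_integrableOn_Ioc_of_le zero_le_one] at hc

lemma two_mul_agmIntegral_sqrt_two_one :
    2 * agmIntegral √2 1 =
      ∫ u in Ioo (0 : ℝ) 1, u ^ ((1 / 4 : ℝ) - 1) * (1 - u) ^ ((1 / 2 : ℝ) - 1) := by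
  have hderiv : ∀ x ∈ Ioi (0 : ℝ), HasDerivWithinAt (fun x : ℝ ↦ ((1 + x ^ 2) ^ 2)⁻¹)
      (-(4 * x / (1 + x ^ 2) ^ 3)) (Ioi 0) x := by
    intro x hx
    have h := ((((hasDerivAt_pow 2 x).const_add 1).fun_pow 2).fun_inv
      (by positivity)).hasDerivWithinAt (s := Ioi 0)
    refine h.congr_deriv ?_
    push_cast
    field_simp
    ring
  have hinj : InjOn (fun x : ℝ ↦ ((1 + x ^ 2) ^ 2)⁻¹) (Ioi 0) := by
    intro x hx y hy h
    have h1 := (pow_left_inj₀ (by positivity) (by positivity) two_ne_zero).mp (inv_injective h)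
    exact (pow_left_inj₀ (le_of_lt hx) (le_of_lt hy) two_ne_zero).mp (by linarith)
  rw [← image_inv_one_add_sq_sq,
    integral_image_eq_integral_abs_deriv_smul measurableSet_Ioi hderiv hinj,
    agmIntegral_eq_two_mul, ← mul_assoc, ← integral_const_mul]
  refine setIntegral_congr_fun measurableSet_Ioi fun x hx ↦ ?_
  have hx' : 0 < x := hx
  have hw : 0 < 1 + x ^ 2 := by positivity
  have hv : 0 < x ^ 2 + 2 := by positivity
  have e1 : (((1 + x ^ 2) ^ 2)⁻¹) ^ ((1 / 4 : ℝ) - 1) = (1 + x ^ 2) * √(1 + x ^ 2) := by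
    rw [sqrt_eq_rpow, ← rpow_natCast, ← rpow_neg hw.le, ← rpow_mul hw.le]
    nth_rewrite 2 [← rpow_one (1 + x ^ 2)]
    rw [← rpow_add hw]
    norm_num
  have e2 : (1 - ((1 + x ^ 2) ^ 2)⁻¹) ^ ((1 / 2 : ℝ) - 1) = (1 + x ^ 2) / (x * √(x ^ 2 + 2)) := by
    rw [show 1 - ((1 + x ^ 2) ^ 2)⁻¹ = (x / (1 + x ^ 2)) ^ 2 * (x ^ 2 + 2) by field_simp; ring,
      show (1 / 2 : ℝ) - 1 = -(1 / 2) by norm_num, rpow_neg (by positivity), ← sqrt_eq_rpow,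
      sqrt_mul (by positivity), sqrt_sq (by positivity)]
    field_simp
  have hsw : √(1 + x ^ 2) ^ 2 = 1 + x ^ 2 := sq_sqrt hw.le
  have hsw0 : 0 < √(1 + x ^ 2) := sqrt_pos.mpr hw
  have hsv0 : 0 < √(x ^ 2 + 2) := sqrt_pos.mpr hv
  simp only [smul_eq_mul]
  rw [e1, e2, abs_neg, abs_of_pos (by positivity), sq_sqrt (by norm_num), sqrt_mul hv.le, one_pow,
    add_comm (x ^ 2) 1]
  field_simp
  rw [hsw]
  ring

lemma agmIntegral_sqrt_two_one : agmIntegral √2 1 = Gamma (1 / 4) ^ 2 / (2 * √(2 * π)) := by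
  have h := two_mul_agmIntegral_sqrt_two_one
  rw [integral_rpow_mul_one_sub_rpow (by norm_num) (by norm_num), Gamma_one_half_eq] at h
  have hr := Gamma_mul_Gamma_one_sub (1 / 4)
  rw [show π * (1 / 4) = π / 4 by ring, sin_pi_div_four] at hr
  norm_num at h hr
  have h34 : 0 < Gamma (3 / 4) := Gamma_pos_of_pos (by norm_num)
  have h2 : √2 ^ 2 = 2 := sq_sqrt (by norm_num)
  have hp : √π ^ 2 = π := sq_sqrt pi_pos.le
  have h20 : 0 < √2 := sqrt_pos.mpr (by norm_num)
  have hp0 : 0 < √π := sqrt_pos.mpr pi_pos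
  rw [sqrt_mul (by norm_num)]
  have hr' : Gamma (1 / 4) * Gamma (3 / 4) = √2 * √π ^ 2 := by
    rw [hr, hp]; field_simp; rw [h2]
  rw [eq_div_iff h34.ne'] at h
  rw [eq_div_iff (by positivity)]
  refine mul_right_cancel₀ (mul_pos h34 hp0).ne' ?_
  linear_combination (√2 * √π ^ 2) * h - Gamma (1 / 4) * √π * hr'

lemma theta4_pi_pow_four : theta4 π ^ 4 = Gamma (1 / 4) ^ 4 / (8 * π ^ 3) := by
  have h2 : √2 ^ 2 = 2 := sq_sqrt (by norm_num)
  have hb : 0 < theta4 π ^ 2 := sq_pos_of_ne_zero (theta4_ne_zero pi_pos)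
  have h3 : theta3 π ^ 2 = theta4 π ^ 2 * √2 := by
    refine (pow_left_inj₀ (by positivity) (by positivity) two_ne_zero).mp ?_
    rw [mul_pow, h2, ← pow_mul, ← pow_mul, theta3_pi_pow_four, mul_comm]
  have h := agmIntegral_theta pi_pos
  rw [h3, ← mul_one (theta4 π ^ 2), mul_assoc, one_mul, agmIntegral_mul hb,
    agmIntegral_sqrt_two_one, inv_mul_eq_iff_eq_mul₀ hb.ne'] at h
  have hs : √(2 * π) ^ 2 = 2 * π := sq_sqrt (by positivity)
  have hs0 : 0 < √(2 * π) := sqrt_pos.mpr (by positivity)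
  rw [show theta4 π ^ 4 = (theta4 π ^ 2) ^ 2 by ring, eq_div_of_mul_eq pi_pos.ne' h.symm, div_pow,
    div_pow, mul_pow, hs]
  field_simp
  ring

end AGM

lemma g_eq_sqrt {Q : ℝ} (hQ0 : 0 < Q) (hQ1 : Q < 1) : g Q = √(sqrtModulus (-log Q) / 2) := by
  have h := two_mul_g_exp_neg_sq (neg_pos.mpr (log_neg hQ0 hQ1))
  rw [neg_neg, exp_log hQ0] at h
  rw [← h, mul_div_cancel_left₀ _ two_ne_zero, sqrt_sq (g_pos hQ0 hQ1).le]

lemma sqrtModulus_pi_pow_four : sqrtModulus π ^ 4 = 1 / 2 := by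
  have h := pow_pos (theta3_pos pi_pos) 4
  rw [sqrtModulus, div_pow, theta2_pi_eq_theta4_pi, div_eq_div_iff h.ne' two_ne_zero,
    theta3_pi_pow_four]
  ring

lemma sqrt_sqrtModulus_pi : √(sqrtModulus π / 2) = (2 ^ ((5 : ℝ) / 8))⁻¹ := by
  have hk := sqrtModulus_pos pi_pos
  refine (pow_left_inj₀ (by positivity) (by positivity) (n := 8) (by norm_num)).mp ?_
  have h5 : ((2 : ℝ) ^ ((5 : ℝ) / 8)) ^ 8 = 32 := by
    rw [← rpow_natCast, ← rpow_mul two_pos.le]; norm_num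
  rw [inv_pow, h5, show √(sqrtModulus π / 2) ^ 8 = (√(sqrtModulus π / 2) ^ 2) ^ 4 by ring,
    sq_sqrt (by positivity), div_pow, sqrtModulus_pi_pow_four]
  norm_num

lemma hasDerivAt_sqrtModulus_pi :
    HasDerivAt sqrtModulus (sqrtModulus π * -(Gamma (1 / 4) ^ 4 / (32 * π ^ 3))) π := by
  have hk := sqrtModulus_pos pi_pos
  refine (differentiableAt_sqrtModulus pi_pos).hasDerivAt.congr_deriv ?_
  have h := logDeriv_sqrtModulus_eq pi_pos
  rw [logDeriv_apply, div_eq_iff hk.ne', theta4_pi_pow_four] at h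
  rw [h]
  ring

end ThetaFunctions

theorem g_hasDerivAt_exp_neg_pi :
    HasDerivAt g
      (Real.exp π * Real.Gamma (1 / 4) ^ 4 / (64 * 2 ^ ((5 : ℝ) / 8) * π ^ 3))
      (Real.exp (-π)) := by
  have hk := sqrtModulus_pos pi_pos
  have hQ1 : Real.exp (-π) < 1 := by simpa using pi_pos
  have hlog : -Real.log (Real.exp (-π)) = π := by rw [Real.log_exp, neg_neg]
  have heq : g =ᶠ[nhds (Real.exp (-π))] fun Q ↦ √(sqrtModulus (-Real.log Q) / 2) :=
    Filter.eventually_of_mem (Ioo_mem_nhds (Real.exp_pos _) hQ1) fun Q hQ ↦ g_eq_sqrt hQ.1 hQ.2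
  have h := ((hasDerivAt_sqrtModulus_pi.comp_of_eq (Real.exp (-π))
    (Real.hasDerivAt_log (Real.exp_pos _).ne').fun_neg hlog.symm).div_const 2).sqrt
      (by simp only [Function.comp_apply, hlog]; positivity)
  refine HasDerivAt.congr_of_eventuallyEq (h.congr_deriv ?_) heq
  have hs := sqrt_sqrtModulus_pi
  have hs2 : √(sqrtModulus π / 2) ^ 2 = sqrtModulus π / 2 := Real.sq_sqrt (by positivity)
  simp only [Function.comp_apply, hlog]
  rw [hs] at hs2 ⊢
  rw [show sqrtModulus π = 2 * ((2 ^ ((5 : ℝ) / 8))⁻¹) ^ 2 by rw [hs2]; ring, Real.exp_neg]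
  have h5 : (0 : ℝ) < 2 ^ ((5 : ℝ) / 8) := by positivity
  field_simp
  norm_num
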